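/- Whitehead's second lemma in explicit form: let g be a finite-dimensional complex semisimple Lie algebra and let c : g → g → g be a bilinear map that is alternating (c x y = −c y x for all x, y) and satisfies the 2-cocycle identity ⁅x, c y z⁆ − ⁅y, c x z⁆ + ⁅z, c x y⁆ − c ⁅x,y⁆ z + c ⁅x,z⁆ y − c ⁅y,z⁆ x = 0 for all x, y, z ∈ g. Then there exists a linear map f : g → g such that c x y = ⁅f x, y⁆ + ⁅x, f y⁆ − f ⁅x, y⁆ for all x, y ∈ g. -/

import Mathlib

namespace LieAlgebra.IsKilling

open LinearMap Module

variable {K L ι : Type*} [Field K] [LieRing L] [LieAlgebra K L] [IsKilling K L]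
  [Fintype ι] [DecidableEq ι]

variable (K L) in
/-- The basis dual to `b` with respect to the Killing form. -/
noncomputable abbrev killingDualBasis (b : Module.Basis ι K L) : Module.Basis ι K L :=
  BilinForm.dualBasis (killingForm K L) (killingForm_nondegenerate K L) b

lemma sum_killingForm_smul_killingDualBasis (b : Module.Basis ι K L) (x : L) :
    ∑ i, killingForm K L x (b i) • killingDualBasis K L b i = x := by
  conv_rhs => rw [← (killingDualBasis K L b).sum_repr x]
  simp only [BilinForm.dualBasis_repr_apply]

lemma sum_killingForm_killingDualBasis_smul (b : Module.Basis ι K L) (x : L) :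
    ∑ i, killingForm K L x (killingDualBasis K L b i) • b i = x := by
  have hb : killingDualBasis K L (killingDualBasis K L b) = b :=
    BilinForm.dualBasis_dualBasis _ ⟨LieModule.traceForm_comm K L L⟩ b
  simpa only [hb] using sum_killingForm_smul_killingDualBasis (killingDualBasis K L b) x

/-- The Casimir tensor attached to a pair of Killing-dual bases is invariant. -/
lemma sum_apply_lie_killingDualBasis {M : Type*} [AddCommGroup M] [Module K M]
    (b : Module.Basis ι K L) (B : L →ₗ[K] L →ₗ[K] M) (y : L) :
    ∑ i, B ⁅b i, y⁆ (killingDualBasis K L b i) =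
      - ∑ i, B (b i) ⁅killingDualBasis K L b i, y⁆ := by
  have h₁ (i : ι) : B ⁅b i, y⁆ (killingDualBasis K L b i) =
      ∑ j, killingForm K L ⁅b i, y⁆ (killingDualBasis K L b j) •
        B (b j) (killingDualBasis K L b i) := by
    conv_lhs => rw [← sum_killingForm_killingDualBasis_smul b ⁅b i, y⁆]
    simp
  have h₂ (i : ι) : B (b i) ⁅killingDualBasis K L b i, y⁆ =
      ∑ j, killingForm K L ⁅killingDualBasis K L b i, y⁆ (b j) •
        B (b i) (killingDualBasis K L b j) := by
    conv_lhs => rw [← sum_killingForm_smul_killingDualBasis b ⁅killingDualBasis K L b i, y⁆]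
    simp
  simp_rw [h₁, h₂]
  rw [Finset.sum_comm, ← Finset.sum_neg_distrib]
  refine Finset.sum_congr rfl fun i _ ↦ ?_
  rw [← Finset.sum_neg_distrib]
  refine Finset.sum_congr rfl fun j _ ↦ ?_
  rw [LieModule.traceForm_apply_lie_apply, LieModule.traceForm_comm, ← lie_skew, map_neg,
    LinearMap.neg_apply, neg_smul]

/-- The Casimir operator of the Killing form acts as the identity on the adjoint module. -/
lemma sum_lie_lie_killingDualBasis (b : Module.Basis ι K L) (x : L) :
    ∑ i, ⁅b i, ⁅killingDualBasis K L b i, x⁆⁆ = x := by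
  refine ker_eq_bot.mp (ker_killingForm_eq_bot K L) (LinearMap.ext fun y ↦ ?_)
  rw [LieModule.traceForm_comm K L L x y, map_sum, LinearMap.sum_apply,
    killingForm_apply_apply K L y x, trace_eq_matrix_trace K (killingDualBasis K L b), Matrix.trace]
  refine Finset.sum_congr rfl fun i _ ↦ ?_
  rw [Matrix.diag_apply, toMatrix_apply, BilinForm.dualBasis_repr_apply, comp_apply, ad_apply,
    ad_apply, LieModule.traceForm_apply_lie_apply' K L L (b i),
    LieModule.traceForm_apply_lie_apply' K L L y, ← lie_skew x, ← lie_skew y, map_neg, map_neg,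
    LinearMap.neg_apply, neg_neg]

/-- Every alternating 2-cocycle of a Killing Lie algebra with coefficients in the adjoint module is
a coboundary; a primitive is built by contracting with the Casimir tensor of the Killing form. -/
theorem exists_eq_coboundary_of_cocycle [FiniteDimensional K L] (c : L →ₗ[K] L →ₗ[K] L)
    (halt : ∀ x y : L, c x y = - c y x)
    (hcocycle : ∀ x y z : L,
      ⁅x, c y z⁆ - ⁅y, c x z⁆ + ⁅z, c x y⁆
        - c ⁅x, y⁆ z + c ⁅x, z⁆ y - c ⁅y, z⁆ x = 0) :
    ∃ f : L →ₗ[K] L, ∀ x y : L, c x y = ⁅f x, y⁆ + ⁅x, f y⁆ - f ⁅x, y⁆ := by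
  let b := finBasis K L
  let b' := killingDualBasis K L b
  let f : L →ₗ[K] L := ∑ i, (ad K L (b i) : L →ₗ[K] L) ∘ₗ c (b' i)
  have hf (y : L) : f y = ∑ i, ⁅b i, c (b' i) y⁆ := by simp [f]
  have hinv (y z : L) : ∑ i, ⁅b i, ⁅y, c (b' i) z⁆⁆ + ∑ i, ⁅b i, c ⁅b' i, y⁆ z⁆ = ⁅y, f z⁆ := by
    have h := sum_apply_lie_killingDualBasis b
      (((ad K L : L →ₗ[K] End K L).compl₂ (c.flip z))) y
    simp only [compl₂_apply, LieHom.coe_toLinearMap, ad_apply, flip_apply] at h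
    simp_rw [hf, lie_sum, leibniz_lie (b _) y, Finset.sum_add_distrib]
    rw [h]
    abel
  refine ⟨f, fun y z ↦ ?_⟩
  have hsum : ∑ i, ⁅b i, ⁅b' i, c y z⁆ - ⁅y, c (b' i) z⁆ + ⁅z, c (b' i) y⁆
      - c ⁅b' i, y⁆ z + c ⁅b' i, z⁆ y - c ⁅y, z⁆ (b' i)⁆ = 0 :=
    Finset.sum_eq_zero fun i _ ↦ by rw [hcocycle, lie_zero]
  simp only [halt ⁅y, z⁆, lie_add, lie_sub, lie_neg, Finset.sum_add_distrib,
    Finset.sum_sub_distrib, Finset.sum_neg_distrib, ← hf] at hsum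
  rw [sum_lie_lie_killingDualBasis] at hsum
  rw [← hinv, ← lie_skew, ← hinv, eq_comm, ← sub_eq_zero, ← neg_eq_zero, ← hsum]
  abel

end LieAlgebra.IsKilling


/-- Whitehead's second lemma in explicit form: every alternating 2-cocycle of a
finite-dimensional complex semisimple Lie algebra `g` with coefficients in the adjoint
module is a coboundary, i.e. `H²(g, g) = 0`. -/
theorem whitehead_second_lemma_explicit
    (g : Type*) [LieRing g] [LieAlgebra ℂ g] [FiniteDimensional ℂ g]
    [LieAlgebra.IsSemisimple ℂ g]
    (c : g →ₗ[ℂ] g →ₗ[ℂ] g)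
    (halt : ∀ x y : g, c x y = - c y x)
    (hcocycle : ∀ x y z : g,
      ⁅x, c y z⁆ - ⁅y, c x z⁆ + ⁅z, c x y⁆
        - c ⁅x, y⁆ z + c ⁅x, z⁆ y - c ⁅y, z⁆ x = 0) :
    ∃ f : g →ₗ[ℂ] g, ∀ x y : g, c x y = ⁅f x, y⁆ + ⁅x, f y⁆ - f ⁅x, y⁆ := by
  exact LieAlgebra.IsKilling.exists_eq_coboundary_of_cocycle c halt hcocycle
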